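/- Let d ≥ 1, γ0 > 1, b̃ ≥ 0, ν = (γ0+1)/(γ0−1), and consider the isentropic symmetrized system ∂_t π + u·∇π + ((γ0−1)/2)(1 + b̃π^{ν−1})π div u = 0, ∂_t u + (u·∇)u + ((γ0−1)/2)(1 + b̃π^{ν−1})π ∇π = 0 on [0,T0] × ℝ^d. Let U = (π, u) and Ũ = (π̃, ũ) be two C¹ solutions with π, π̃ ≥ 0, and assume ∇Ũ ∈ L^∞([0,T0] × ℝ^d). Let x0 ∈ ℝ^d and R > 0, set M = sup{ ((γ0−1)/2)|π(t,x)|(1 + b̃ π(t,x)^{ν−1}) + |u(t,x)| : (t,x) ∈ [0,T0] × B̄(x0,R) } and T1 = min(T0, R/M). If U(0,·) = Ũ(0,·) on B̄(x0,R), then U = Ũ on the cone C_{T1} = {(t,x) : 0 ≤ t ≤ T1, |x − x0| ≤ R − Mt}. -/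

import Mathlib

theorem integral_fderiv_apply_eq_zero {E : Type*} [NormedAddCommGroup E] [InnerProductSpace ℝ E]
    [FiniteDimensional ℝ E] [MeasurableSpace E] [BorelSpace E] {g : E → ℝ}
    (hg : ContDiff ℝ 1 g) (hc : HasCompactSupport g) (v : E) :
    ∫ x, fderiv ℝ g x v = 0 := by
  have hcont : Continuous fun x => fderiv ℝ g x v :=
    (hg.continuous_fderiv one_ne_zero).clm_apply continuous_const
  have hcs : HasCompactSupport fun x => fderiv ℝ g x v := hc.fderiv_apply ℝ v
  have h := integral_mul_fderiv_eq_neg_fderiv_mul_of_integrable (μ := MeasureTheory.volume)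
    (f := fun _ : E => (1 : ℝ)) (g := g) (v := v)
    (by simp) (by simpa using hcont.integrable_of_hasCompactSupport hcs)
    (by simpa using hg.continuous.integrable_of_hasCompactSupport hc)
    (fun x _ => differentiableAt_const _)
    (fun x _ => (hg.differentiable one_ne_zero) x)
  simpa [Function.comp_def] using h

theorem hasFDerivAt_slice {E G : Type*} [NormedAddCommGroup E] [NormedSpace ℝ E]
    [NormedAddCommGroup G] [NormedSpace ℝ G] {f : ℝ × E → G} {t : ℝ} {x : E}
    (hf : DifferentiableAt ℝ f (t, x)) :
    HasFDerivAt (fun y => f (t, y))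
      ((fderiv ℝ f (t, x)).comp (ContinuousLinearMap.inr ℝ ℝ E)) x :=
  hf.hasFDerivAt.comp x (hasFDerivAt_prodMk_right t x)

theorem hasDerivAt_slice {E G : Type*} [NormedAddCommGroup E] [NormedSpace ℝ E]
    [NormedAddCommGroup G] [NormedSpace ℝ G] {f : ℝ × E → G} {t : ℝ} {x : E}
    (hf : DifferentiableAt ℝ f (t, x)) :
    HasDerivAt (fun s => f (s, x)) (fderiv ℝ f (t, x) (1, 0)) t := by
  have h := (hf.hasFDerivAt.comp t (hasFDerivAt_prodMk_left t x)).hasDerivAt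
  simpa [Function.comp_def] using h

/-- Grönwall in integrated form: a nonnegative density which satisfies a differential inequality
with a compactly supported flux and starts from zero stays zero. -/
theorem eq_zero_of_balance_le {d : ℕ} {T C : ℝ} {K : Set (EuclideanSpace ℝ (Fin d))}
    (hK : IsCompact K) {Φ : ℝ × EuclideanSpace ℝ (Fin d) → ℝ}
    {G : ℝ × EuclideanSpace ℝ (Fin d) → EuclideanSpace ℝ (Fin d)}
    (hΦc : ContinuousOn Φ (Set.Icc 0 T ×ˢ Set.univ))
    (hΦ : ContDiffOn ℝ 1 Φ (Set.Ioo 0 T ×ˢ Set.univ))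
    (hG : ContDiffOn ℝ 1 G (Set.Ioo 0 T ×ˢ Set.univ))
    (hΦK : ∀ t ∈ Set.Icc 0 T, ∀ x ∉ K, Φ (t, x) = 0)
    (hGK : ∀ t ∈ Set.Icc 0 T, ∀ x ∉ K, G (t, x) = 0)
    (hpos : ∀ t ∈ Set.Icc 0 T, ∀ x, 0 ≤ Φ (t, x))
    (hinit : ∀ x, Φ (0, x) = 0)
    (hle : ∀ t ∈ Set.Ioo 0 T, ∀ x, fderiv ℝ Φ (t, x) (1, 0) +
      ∑ j, fderiv ℝ G (t, x) (0, EuclideanSpace.single j 1) j ≤ C * Φ (t, x)) :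
    ∀ t ∈ Set.Icc 0 T, ∀ x, Φ (t, x) = 0 := by
  have hopen : IsOpen (Set.Ioo (0 : ℝ) T ×ˢ (Set.univ : Set (EuclideanSpace ℝ (Fin d)))) :=
    isOpen_Ioo.prod isOpen_univ
  have hsub : ∀ t ∈ Set.Ioo 0 T, t ∈ Set.Icc 0 T := fun t h => Set.Ioo_subset_Icc_self h
  have hmem : ∀ t ∈ Set.Ioo 0 T, ∀ x : EuclideanSpace ℝ (Fin d),
      (t, x) ∈ Set.Ioo (0 : ℝ) T ×ˢ (Set.univ : Set (EuclideanSpace ℝ (Fin d))) :=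
    fun t h x => ⟨h, trivial⟩
  have hΦd : ∀ t ∈ Set.Ioo 0 T, ∀ x, DifferentiableAt ℝ Φ (t, x) := fun t h x =>
    (hΦ.contDiffAt (hopen.mem_nhds (hmem t h x))).differentiableAt one_ne_zero
  have hGd : ∀ t ∈ Set.Ioo 0 T, ∀ x, DifferentiableAt ℝ G (t, x) := fun t h x =>
    (hG.contDiffAt (hopen.mem_nhds (hmem t h x))).differentiableAt one_ne_zero
  have hΦ'c : ContinuousOn (fun z => fderiv ℝ Φ z (1, 0)) (Set.Ioo 0 T ×ˢ Set.univ) :=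
    (hΦ.continuousOn_fderiv_of_isOpen hopen le_rfl).clm_apply continuousOn_const
  have hΦ'K : ∀ t ∈ Set.Ioo 0 T, ∀ x ∉ K, fderiv ℝ Φ (t, x) (1, 0) = 0 := by
    intro t ht x hx
    have h1 := hasDerivAt_slice (hΦd t ht x)
    have h2 : (fun s => Φ (s, x)) =ᶠ[nhds t] fun _ => 0 := by
      filter_upwards [Ioo_mem_nhds ht.1 ht.2] with s hs using hΦK s (hsub s hs) x hx
    exact h1.unique ((hasDerivAt_const t (0 : ℝ)).congr_of_eventuallyEq h2)
  have hslice : ∀ t ∈ Set.Icc 0 T, Continuous fun x => Φ (t, x) := fun t ht =>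
    hΦc.comp_continuous (by fun_prop) (fun x => ⟨ht, trivial⟩)
  have hcs : ∀ t ∈ Set.Icc 0 T, HasCompactSupport fun x => Φ (t, x) := fun t ht =>
    HasCompactSupport.intro hK (hΦK t ht)
  have hIc : ContinuousOn (fun t => ∫ x, Φ (t, x)) (Set.Icc 0 T) :=
    continuousOn_integral_of_compact_support hK (f := fun t x => Φ (t, x)) hΦc
      (fun t x ht hx => hΦK t ht x hx)
  have hderiv : ∀ t ∈ Set.Ioo 0 T, HasDerivAt (fun t => ∫ x, Φ (t, x))
      (∫ x, fderiv ℝ Φ (t, x) (1, 0)) t := by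
    intro t ht
    obtain ⟨a, b, htab, habT⟩ : ∃ a b, t ∈ Set.Ioo a b ∧ Set.Icc a b ⊆ Set.Ioo 0 T :=
      ⟨t / 2, (t + T) / 2, ⟨by linarith [ht.1], by linarith [ht.2]⟩, fun s hs =>
        ⟨by linarith [hs.1, ht.1], by linarith [hs.2, ht.2]⟩⟩
    obtain ⟨B, hB⟩ := (isCompact_Icc.prod hK).exists_bound_of_continuousOn
      (hΦ'c.mono (Set.prod_mono habT (Set.subset_univ K)))
    refine (hasDerivAt_integral_of_dominated_loc_of_deriv_le (F := fun t x => Φ (t, x))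
      (F' := fun t x => fderiv ℝ Φ (t, x) (1, 0)) (bound := K.indicator fun _ => B)
      (Ioo_mem_nhds htab.1 htab.2) ?_ ?_ ?_ ?_ ?_ ?_).2
    · filter_upwards [Ioo_mem_nhds ht.1 ht.2] with s hs
      exact (hslice s (hsub s hs)).aestronglyMeasurable
    · exact (hslice t (hsub t ht)).integrable_of_hasCompactSupport (hcs t (hsub t ht))
    · exact (hΦ'c.comp_continuous (f := fun x => (t, x)) (by fun_prop)
        (fun x => ⟨ht, trivial⟩)).aestronglyMeasurable
    · refine Filter.Eventually.of_forall fun x s hs => ?_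
      by_cases hx : x ∈ K
      · rw [Set.indicator_of_mem hx]
        exact hB (s, x) ⟨Set.Ioo_subset_Icc_self hs, hx⟩
      · rw [Set.indicator_of_notMem hx]
        simp only [hΦ'K s (habT (Set.Ioo_subset_Icc_self hs)) x hx, norm_zero, le_refl]
    · exact (MeasureTheory.integrable_indicator_iff hK.isClosed.measurableSet).2
        (MeasureTheory.integrableOn_const hK.measure_ne_top)
    · exact Filter.Eventually.of_forall fun x s hs =>
        hasDerivAt_slice (hΦd s (habT (Set.Ioo_subset_Icc_self hs)) x)
  have hbound : ∀ t ∈ Set.Ioo 0 T,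
      ∫ x, fderiv ℝ Φ (t, x) (1, 0) ≤ C * ∫ x, Φ (t, x) := by
    intro t ht
    have hGt : ∀ j, ContDiff ℝ 1 fun x => G (t, x) j := fun j => by
      have h1 : ContDiff ℝ 1 fun x => G (t, x) :=
        hG.comp_contDiff (f := fun x => (t, x)) (by fun_prop) (fun x => ⟨ht, trivial⟩)
      exact (EuclideanSpace.proj (𝕜 := ℝ) j).contDiff.comp h1
    have hGs : ∀ j, HasCompactSupport fun x => G (t, x) j := fun j =>
      HasCompactSupport.intro hK fun x hx => by simp [hGK t (hsub t ht) x hx]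
    have hGeq : ∀ j x, fderiv ℝ (fun y => G (t, y) j) x (EuclideanSpace.single j 1) =
        fderiv ℝ G (t, x) (0, EuclideanSpace.single j 1) j := fun j x => by
      have h1 := ((EuclideanSpace.proj (𝕜 := ℝ) j).hasFDerivAt.comp x
        (hasFDerivAt_slice (hGd t ht x))).fderiv
      have h2 := congrArg (fun L => L (EuclideanSpace.single j 1)) h1
      simpa [Function.comp_def] using h2
    have hGi : ∀ j, MeasureTheory.Integrable fun x =>
        fderiv ℝ G (t, x) (0, EuclideanSpace.single j 1) j := fun j => by
      simp only [← hGeq]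
      exact (((hGt j).continuous_fderiv one_ne_zero).clm_apply
        continuous_const).integrable_of_hasCompactSupport ((hGs j).fderiv_apply ℝ _)
    have hG0 : ∫ x, ∑ j, fderiv ℝ G (t, x) (0, EuclideanSpace.single j 1) j = 0 := by
      rw [MeasureTheory.integral_finsetSum _ fun j _ => hGi j]
      refine Finset.sum_eq_zero fun j _ => ?_
      simp only [← hGeq]
      exact integral_fderiv_apply_eq_zero (hGt j) (hGs j) _
    have hΦi := (hslice t (hsub t ht)).integrable_of_hasCompactSupport
      (μ := MeasureTheory.volume) (hcs t (hsub t ht))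
    have hΦ'i : MeasureTheory.Integrable fun x => fderiv ℝ Φ (t, x) (1, 0) :=
      (hΦ'c.comp_continuous (f := fun x => (t, x)) (by fun_prop)
        (fun x => ⟨ht, trivial⟩)).integrable_of_hasCompactSupport
        (HasCompactSupport.intro hK (hΦ'K t ht))
    have hm := MeasureTheory.integral_mono
      (hΦ'i.add (MeasureTheory.integrable_finsetSum _ fun j _ => hGi j)) (hΦi.const_mul C)
      (fun x => by simpa using hle t ht x)
    rw [MeasureTheory.integral_const_mul] at hm
    simp only [Pi.add_apply] at hm
    rw [MeasureTheory.integral_add hΦ'i (MeasureTheory.integrable_finsetSum _ fun j _ => hGi j),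
      hG0, add_zero] at hm
    exact hm
  have hanti : AntitoneOn (fun t => Real.exp (-C * t) * ∫ x, Φ (t, x)) (Set.Icc 0 T) := by
    have hd : ∀ t ∈ Set.Ioo 0 T, HasDerivAt (fun t => Real.exp (-C * t) * ∫ x, Φ (t, x))
        (Real.exp (-C * t) * (-C) * (∫ x, Φ (t, x)) +
          Real.exp (-C * t) * ∫ x, fderiv ℝ Φ (t, x) (1, 0)) t := fun t ht => by
      have h1 : HasDerivAt (fun t => Real.exp (-C * t)) (Real.exp (-C * t) * (-C)) t := by
        simpa using ((hasDerivAt_id t).const_mul (-C)).exp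
      exact h1.mul (hderiv t ht)
    refine antitoneOn_of_deriv_nonpos (convex_Icc 0 T)
      ((by fun_prop : Continuous fun t : ℝ => Real.exp (-C * t)).continuousOn.mul hIc) ?_ ?_
    · rw [interior_Icc]
      exact fun t ht => (hd t ht).differentiableAt.differentiableWithinAt
    · rw [interior_Icc]
      intro t ht
      rw [(hd t ht).deriv]
      nlinarith [hbound t ht, Real.exp_pos (-C * t)]
  intro t ht x
  have h0 : (0 : ℝ) ∈ Set.Icc 0 T := ⟨le_rfl, ht.1.trans ht.2⟩
  have h1 := hanti h0 ht ht.1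
  simp only [hinit, MeasureTheory.integral_zero, mul_zero] at h1
  by_contra hne
  have h2 := (hslice t ht).integral_pos_of_hasCompactSupport_nonneg_nonzero
    (μ := MeasureTheory.volume) (hcs t ht) (fun y => hpos t ht y) hne
  exact absurd h1 (not_le.2 (mul_pos (Real.exp_pos _) h2))

/-- Smooth cutoff positive exactly in a smoothed backward cone. -/
noncomputable def coneCutoff {d : ℕ} (x₀ : EuclideanSpace ℝ (Fin d)) (R M ε : ℝ)
    (z : ℝ × EuclideanSpace ℝ (Fin d)) : ℝ :=
  expNegInvGlue (R - M * z.1 - √(‖z.2 - x₀‖ ^ 2 + ε ^ 2))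

theorem coneCutoff_contDiff {d : ℕ} (x₀ : EuclideanSpace ℝ (Fin d)) (R M : ℝ) {ε : ℝ}
    (hε : 0 < ε) : ContDiff ℝ 1 (coneCutoff x₀ R M ε) := by
  have h1 : ContDiff ℝ 1 fun z : ℝ × EuclideanSpace ℝ (Fin d) => √(‖z.2 - x₀‖ ^ 2 + ε ^ 2) :=
    (((contDiff_snd.sub contDiff_const).norm_sq ℝ).add contDiff_const).sqrt
      fun z => by positivity
  have h2 : ContDiff ℝ ((1 : ℕ∞) : WithTop ℕ∞) expNegInvGlue := expNegInvGlue.contDiff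
  exact h2.comp ((contDiff_const.sub (contDiff_const.mul contDiff_fst)).sub h1)

/-- The differential of the cutoff is `-k (M dt + ⟪v, dx⟫)` with `k ≥ 0`, `‖v‖ ≤ 1`. -/
theorem coneCutoff_fderiv {d : ℕ} (x₀ : EuclideanSpace ℝ (Fin d)) (R M : ℝ) {ε : ℝ}
    (hε : 0 < ε) (z : ℝ × EuclideanSpace ℝ (Fin d)) :
    ∃ (k : ℝ) (v : EuclideanSpace ℝ (Fin d)), 0 ≤ k ∧ ‖v‖ ≤ 1 ∧
      (R - M * z.1 ≤ ‖z.2 - x₀‖ → k = 0) ∧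
      ∀ s y, fderiv ℝ (coneCutoff x₀ R M ε) z (s, y) = -k * (M * s + inner ℝ v y) := by
  set r := √(‖z.2 - x₀‖ ^ 2 + ε ^ 2) with hr
  have hrpos : 0 < r := Real.sqrt_pos.2 (by positivity)
  have hrge : ‖z.2 - x₀‖ ≤ r := Real.le_sqrt_of_sq_le (by nlinarith)
  refine ⟨deriv expNegInvGlue (R - M * z.1 - r), r⁻¹ • (z.2 - x₀),
    expNegInvGlue.monotone.deriv_nonneg, ?_, ?_, ?_⟩
  · rw [norm_smul, norm_inv, Real.norm_of_nonneg hrpos.le, inv_mul_le_iff₀ hrpos]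
    simpa using hrge
  · intro h
    refine IsLocalMin.deriv_eq_zero (Filter.Eventually.of_forall fun s => ?_)
    rw [expNegInvGlue.zero_of_nonpos (by linarith)]
    exact expNegInvGlue.nonneg s
  · intro s y
    have h2 : ContDiff ℝ ((1 : ℕ∞) : WithTop ℕ∞) expNegInvGlue := expNegInvGlue.contDiff
    have hh := ((h2.differentiable one_ne_zero) (R - M * z.1 - r)).hasDerivAt
    have hn := ((hasFDerivAt_snd (𝕜 := ℝ) (p := z)).sub_const x₀).norm_sq
    have hs := (hn.add_const (ε ^ 2)).sqrt (by positivity)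
    have hin := (((hasFDerivAt_fst (𝕜 := ℝ) (p := z)).const_mul M).const_sub R).sub hs
    have hf : HasFDerivAt (coneCutoff x₀ R M ε) _ z := hh.comp_hasFDerivAt z hin
    rw [hf.fderiv]
    simp [← hr, inner_smul_left, inner_sub_left]
    field_simp
    ring

theorem coneCutoff_eq_zero {d : ℕ} {x₀ : EuclideanSpace ℝ (Fin d)} {R M ε : ℝ}
    {z : ℝ × EuclideanSpace ℝ (Fin d)} (h : R - M * z.1 ≤ ‖z.2 - x₀‖) :
    coneCutoff x₀ R M ε z = 0 := by
  have : ‖z.2 - x₀‖ ≤ √(‖z.2 - x₀‖ ^ 2 + ε ^ 2) := Real.le_sqrt_of_sq_le (by nlinarith)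
  exact expNegInvGlue.zero_of_nonpos (by linarith)

/-- A nonnegative density which satisfies a balance inequality on a cylinder, with flux bounded
by `M` times the density, and vanishes initially, vanishes in the backward cone of speed `M`. -/
theorem eq_zero_on_cone {d : ℕ} {T C M R : ℝ} (hM : 0 ≤ M) {x₀ : EuclideanSpace ℝ (Fin d)}
    {e : ℝ × EuclideanSpace ℝ (Fin d) → ℝ}
    {F : ℝ × EuclideanSpace ℝ (Fin d) → EuclideanSpace ℝ (Fin d)}
    (hec : ContinuousOn e (Set.Icc 0 T ×ˢ Set.univ))
    (he : ContDiffOn ℝ 1 e (Set.Ioo 0 T ×ˢ Set.univ))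
    (hF : ContDiffOn ℝ 1 F (Set.Ioo 0 T ×ˢ Set.univ))
    (hpos : ∀ t ∈ Set.Icc 0 T, ∀ x, 0 ≤ e (t, x))
    (hinit : ∀ x, ‖x - x₀‖ ≤ R → e (0, x) = 0)
    (hflux : ∀ t ∈ Set.Ioo 0 T, ∀ x, ‖x - x₀‖ ≤ R → ‖F (t, x)‖ ≤ M * e (t, x))
    (hle : ∀ t ∈ Set.Ioo 0 T, ∀ x, ‖x - x₀‖ ≤ R → fderiv ℝ e (t, x) (1, 0) +
      ∑ j, fderiv ℝ F (t, x) (0, EuclideanSpace.single j 1) j ≤ C * e (t, x)) :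
    ∀ t ∈ Set.Icc 0 T, ∀ x, ‖x - x₀‖ < R - M * t → e (t, x) = 0 := by
  intro t ht x hx
  obtain ⟨ε, hε, hεx⟩ : ∃ ε > 0, √(‖x - x₀‖ ^ 2 + ε ^ 2) < R - M * t := by
    have hpos : 0 < (R - M * t) ^ 2 - ‖x - x₀‖ ^ 2 := by nlinarith [norm_nonneg (x - x₀)]
    refine ⟨√(((R - M * t) ^ 2 - ‖x - x₀‖ ^ 2) / 2), Real.sqrt_pos.2 (by linarith), ?_⟩
    rw [Real.sq_sqrt (by linarith)]
    exact (Real.sqrt_lt' (by linarith [norm_nonneg (x - x₀)])).2 (by linarith)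
  set φ := coneCutoff x₀ R M ε with hφ
  have hφC : ContDiff ℝ 1 φ := coneCutoff_contDiff x₀ R M hε
  have hφnn : ∀ z, 0 ≤ φ z := fun z => expNegInvGlue.nonneg _
  have hφ0 : ∀ s, 0 ≤ s → ∀ y, R ≤ ‖y - x₀‖ → φ (s, y) = 0 := fun s hs y hy =>
    coneCutoff_eq_zero (by dsimp only; nlinarith)
  have hout : ∀ y ∉ Metric.closedBall x₀ R, R ≤ ‖y - x₀‖ := fun y hy => by
    rw [Metric.mem_closedBall, dist_eq_norm, not_le] at hy
    exact hy.le
  have hopen : IsOpen (Set.Ioo (0 : ℝ) T ×ˢ (Set.univ : Set (EuclideanSpace ℝ (Fin d)))) :=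
    isOpen_Ioo.prod isOpen_univ
  have key := eq_zero_of_balance_le (C := C) (isCompact_closedBall x₀ R)
    (Φ := fun z => φ z * e z) (G := fun z => φ z • F z)
    (hφC.continuous.continuousOn.mul hec) (hφC.contDiffOn.mul he) (hφC.contDiffOn.smul hF)
    (fun s hs y hy => by simp [hφ0 s hs.1 y (hout y hy)])
    (fun s hs y hy => by simp [hφ0 s hs.1 y (hout y hy)])
    (fun s hs y => mul_nonneg (hφnn _) (hpos s hs y))
    (fun y => by
      rcases le_total ‖y - x₀‖ R with h | h
      · simp [hinit y h]
      · simp [hφ0 0 le_rfl y h])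
    (fun s hs y => by
      have hmem := hopen.mem_nhds (show (s, y) ∈ Set.Ioo (0 : ℝ) T ×ˢ Set.univ from ⟨hs, trivial⟩)
      have h1 := (((hφC.differentiable one_ne_zero) (s, y)).hasFDerivAt.mul
        ((he.contDiffAt hmem).differentiableAt one_ne_zero).hasFDerivAt).fderiv
      have h2 := (((hφC.differentiable one_ne_zero) (s, y)).hasFDerivAt.smul
        ((hF.contDiffAt hmem).differentiableAt one_ne_zero).hasFDerivAt).fderiv
      obtain ⟨k, v, hk, hv, hk0, hkv⟩ := coneCutoff_fderiv x₀ R M hε (s, y)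
      have hsum : ∑ j, inner ℝ v (EuclideanSpace.single j (1 : ℝ)) * F (s, y) j =
          inner ℝ v (F (s, y)) := by
        simp [PiLp.inner_apply, mul_comm]
      have hk1 : 0 ≤ k * (M * e (s, y) + inner ℝ v (F (s, y))) := by
        rcases le_total ‖y - x₀‖ R with h | h
        · have h3 := hflux s hs y h
          have h4 := abs_le.1 (abs_real_inner_le_norm v (F (s, y)))
          have h5 : ‖v‖ * ‖F (s, y)‖ ≤ ‖F (s, y)‖ :=
            mul_le_of_le_one_left (norm_nonneg _) hv
          exact mul_nonneg hk (by linarith)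
        · rw [hk0 (by dsimp only; nlinarith [hs.1]), zero_mul]
      have hφle : φ (s, y) * (fderiv ℝ e (s, y) (1, 0) +
          ∑ j, fderiv ℝ F (s, y) (0, EuclideanSpace.single j 1) j) ≤
          φ (s, y) * (C * e (s, y)) := by
        rcases le_total ‖y - x₀‖ R with h | h
        · exact mul_le_mul_of_nonneg_left (hle s hs y h) (hφnn _)
        · simp [hφ0 s hs.1.le y h]
      have heq : fderiv ℝ (fun z => φ z * e z) (s, y) (1, 0) +
          ∑ j, fderiv ℝ (fun z => φ z • F z) (s, y) (0, EuclideanSpace.single j 1) j =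
          φ (s, y) * (fderiv ℝ e (s, y) (1, 0) +
          ∑ j, fderiv ℝ F (s, y) (0, EuclideanSpace.single j 1) j) -
          k * (M * e (s, y) + inner ℝ v (F (s, y))) := by
        have h1' : fderiv ℝ (fun z => φ z * e z) (s, y) = _ := h1
        have h2' : fderiv ℝ (fun z => φ z • F z) (s, y) = _ := h2
        rw [h1', h2', ← hsum]
        simp only [add_apply, smul_apply,
          ContinuousLinearMap.smulRight_apply, PiLp.add_apply, PiLp.smul_apply, smul_eq_mul, hφ,
          hkv, Finset.sum_add_distrib, mul_add, Finset.mul_sum, inner_zero_right, mul_zero,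
          zero_add, mul_one]
        simp only [add_zero, neg_mul, Finset.sum_neg_distrib, mul_assoc]
        ring
      rw [heq]
      linarith [mul_left_comm C (φ (s, y)) (e (s, y))])
  have h := key t ht x
  have hφx : φ (t, x) ≠ 0 := (expNegInvGlue.pos_of_pos (by dsimp only; linarith)).ne'
  exact (mul_eq_zero.1 h).resolve_left hφx

theorem sum_coord_smul_apply_single {d : ℕ} {G : Type*} [NormedAddCommGroup G] [NormedSpace ℝ G]
    (L : ℝ × EuclideanSpace ℝ (Fin d) →L[ℝ] G) (y : EuclideanSpace ℝ (Fin d)) :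
    ∑ j, y j • L (0, EuclideanSpace.single j 1) = L (0, y) := by
  have h := congrArg (fun v => L (0, v)) ((EuclideanSpace.basisFun (Fin d) ℝ).sum_repr y)
  have h2 : ∀ v : EuclideanSpace ℝ (Fin d), L (0, v) =
      (L.comp (ContinuousLinearMap.inr ℝ ℝ (EuclideanSpace ℝ (Fin d)))) v := fun v => by simp
  simp only [h2, map_sum, map_smul] at h ⊢
  simpa using h

theorem exists_bound_fderiv {E G : Type*} [NormedAddCommGroup E] [NormedSpace ℝ E]
    [NormedAddCommGroup G] [NormedSpace ℝ G] {T : ℝ} (hT : 0 < T) {K : Set E} (hK : IsCompact K)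
    {f : ℝ × E → G} (hf : ContDiffOn ℝ 1 f (Set.Icc 0 T ×ˢ Set.univ)) :
    ∃ B, ∀ t ∈ Set.Ioo 0 T, ∀ x ∈ K, ‖fderiv ℝ f (t, x)‖ ≤ B := by
  have hc := hf.continuousOn_fderivWithin
    ((uniqueDiffOn_Icc hT).prod (uniqueDiffOn_univ (𝕜 := ℝ) (E := E))) le_rfl
  obtain ⟨B, hB⟩ := (isCompact_Icc.prod hK).exists_bound_of_continuousOn
    (hc.mono (Set.prod_mono le_rfl (Set.subset_univ K)))
  refine ⟨B, fun t ht x hx => ?_⟩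
  have hn : Set.Icc 0 T ×ˢ (Set.univ : Set E) ∈ nhds (t, x) :=
    prod_mem_nhds (Icc_mem_nhds ht.1 ht.2) Filter.univ_mem
  rw [← fderivWithin_of_mem_nhds hn]
  exact hB (t, x) ⟨Set.Ioo_subset_Icc_self ht, hx⟩

/-- Spatial divergence of a time-dependent vector field. -/
noncomputable def spaceDiv {d : ℕ} (U : ℝ × EuclideanSpace ℝ (Fin d) → EuclideanSpace ℝ (Fin d))
    (z : ℝ × EuclideanSpace ℝ (Fin d)) : ℝ :=
  ∑ j, fderiv ℝ U z (0, EuclideanSpace.single j 1) j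

theorem abs_spaceDiv_le {d : ℕ} {U : ℝ × EuclideanSpace ℝ (Fin d) → EuclideanSpace ℝ (Fin d)}
    {z : ℝ × EuclideanSpace ℝ (Fin d)} {B : ℝ} (hB : ‖fderiv ℝ U z‖ ≤ B) :
    |spaceDiv U z| ≤ d * B := by
  refine (Finset.abs_sum_le_sum_abs _ _).trans ?_
  refine (Finset.sum_le_card_nsmul _ _ B fun j _ => ?_).trans (by simp)
  have h1 := PiLp.norm_apply_le (fderiv ℝ U z (0, EuclideanSpace.single j 1)) j
  have h2 := (fderiv ℝ U z).le_of_opNorm_le hB (0, EuclideanSpace.single j 1)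
  simp only [Prod.norm_mk, norm_zero, PiLp.norm_single, norm_one] at h2
  rw [Real.norm_eq_abs] at h1
  exact h1.trans (h2.trans (by simp))

/-- `(P, U)` solves the symmetric system with sound speed `g P` at the point `z`. -/
def SolvesAt {d : ℕ} (g : ℝ → ℝ) (P : ℝ × EuclideanSpace ℝ (Fin d) → ℝ)
    (U : ℝ × EuclideanSpace ℝ (Fin d) → EuclideanSpace ℝ (Fin d))
    (z : ℝ × EuclideanSpace ℝ (Fin d)) : Prop :=
  fderiv ℝ P z (1, 0) + fderiv ℝ P z (0, U z) + g (P z) * spaceDiv U z = 0 ∧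
  ∀ i, fderiv ℝ U z (1, 0) i + fderiv ℝ U z (0, U z) i +
    g (P z) * fderiv ℝ P z (0, EuclideanSpace.single i 1) = 0

theorem SolvesAt.inner_eq {d : ℕ} {g : ℝ → ℝ} {P : ℝ × EuclideanSpace ℝ (Fin d) → ℝ}
    {U : ℝ × EuclideanSpace ℝ (Fin d) → EuclideanSpace ℝ (Fin d)}
    {z : ℝ × EuclideanSpace ℝ (Fin d)} (h : SolvesAt g P U z) (w : EuclideanSpace ℝ (Fin d)) :
    inner ℝ w (fderiv ℝ U z (1, 0)) + inner ℝ w (fderiv ℝ U z (0, U z)) +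
      g (P z) * fderiv ℝ P z (0, w) = 0 := by
  rw [← sum_coord_smul_apply_single (fderiv ℝ P z) w]
  simp only [PiLp.inner_apply, Finset.mul_sum, ← Finset.sum_add_distrib]
  refine Finset.sum_eq_zero fun i _ => ?_
  have := h.2 i
  simp only [RCLike.inner_apply, conj_trivial, smul_eq_mul]
  linear_combination w i * this

/-- Energy density of the difference of two states. -/
noncomputable def energyDensity {d : ℕ} (P Q : ℝ × EuclideanSpace ℝ (Fin d) → ℝ)
    (U V : ℝ × EuclideanSpace ℝ (Fin d) → EuclideanSpace ℝ (Fin d))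
    (z : ℝ × EuclideanSpace ℝ (Fin d)) : ℝ :=
  ((P z - Q z) ^ 2 + ‖U z - V z‖ ^ 2) / 2

/-- Energy flux of the difference of two states. -/
noncomputable def energyFlux {d : ℕ} (g : ℝ → ℝ) (P Q : ℝ × EuclideanSpace ℝ (Fin d) → ℝ)
    (U V : ℝ × EuclideanSpace ℝ (Fin d) → EuclideanSpace ℝ (Fin d))
    (z : ℝ × EuclideanSpace ℝ (Fin d)) : EuclideanSpace ℝ (Fin d) :=
  energyDensity P Q U V z • U z + (g (P z) * (P z - Q z)) • (U z - V z)

theorem energy_balance {d : ℕ} {g : ℝ → ℝ} {g' : ℝ} {P Q : ℝ × EuclideanSpace ℝ (Fin d) → ℝ}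
    {U V : ℝ × EuclideanSpace ℝ (Fin d) → EuclideanSpace ℝ (Fin d)}
    {z : ℝ × EuclideanSpace ℝ (Fin d)}
    (hP : DifferentiableAt ℝ P z) (hQ : DifferentiableAt ℝ Q z)
    (hU : DifferentiableAt ℝ U z) (hV : DifferentiableAt ℝ V z) (hg : HasDerivAt g g' (P z))
    (hPU : SolvesAt g P U z) (hQV : SolvesAt g Q V z) :
    fderiv ℝ (energyDensity P Q U V) z (1, 0) + spaceDiv (energyFlux g P Q U V) z =
      energyDensity P Q U V z * spaceDiv U z
      + g' * (P z - Q z) * fderiv ℝ P z (0, U z - V z)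
      - (P z - Q z) * fderiv ℝ Q z (0, U z - V z)
      - (P z - Q z) * (g (P z) - g (Q z)) * spaceDiv V z
      - inner ℝ (U z - V z) (fderiv ℝ V z (0, U z - V z))
      - (g (P z) - g (Q z)) * fderiv ℝ Q z (0, U z - V z) := by
  have hp := hP.hasFDerivAt.sub hQ.hasFDerivAt
  have hw := hU.hasFDerivAt.sub hV.hasFDerivAt
  have he' : HasFDerivAt (energyDensity P Q U V) _ z :=
    ((hp.pow 2).add hw.norm_sq).mul_const (2⁻¹ : ℝ)
  have hF' : HasFDerivAt (energyFlux g P Q U V) _ z :=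
    (he'.smul hU.hasFDerivAt).add (((hg.comp_hasFDerivAt z hP.hasFDerivAt).mul hp).smul hw)
  have hed : ∀ v, fderiv ℝ (energyDensity P Q U V) z v =
      (P z - Q z) * (fderiv ℝ P z v - fderiv ℝ Q z v) +
      inner ℝ (U z - V z) (fderiv ℝ U z v - fderiv ℝ V z v) := fun v => by
    rw [he'.fderiv]
    simp [inner_sub_left, inner_sub_right]
    ring
  have hFd : ∀ v, fderiv ℝ (energyFlux g P Q U V) z v =
      energyDensity P Q U V z • fderiv ℝ U z v +
      fderiv ℝ (energyDensity P Q U V) z v • U z +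
      ((g (P z) * (P z - Q z)) • (fderiv ℝ U z v - fderiv ℝ V z v) +
      (g (P z) * (fderiv ℝ P z v - fderiv ℝ Q z v) + (P z - Q z) * (g' * fderiv ℝ P z v)) •
        (U z - V z)) := fun v => by
    rw [hF'.fderiv, he'.fderiv]
    simp
  have hdiv : spaceDiv (energyFlux g P Q U V) z = energyDensity P Q U V z * spaceDiv U z +
      fderiv ℝ (energyDensity P Q U V) z (0, U z) +
      (g (P z) * (P z - Q z) * (spaceDiv U z - spaceDiv V z) +
      (g (P z) * (fderiv ℝ P z (0, U z - V z) - fderiv ℝ Q z (0, U z - V z)) +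
        (P z - Q z) * (g' * fderiv ℝ P z (0, U z - V z)))) := by
    rw [← sum_coord_smul_apply_single (fderiv ℝ P z), ← sum_coord_smul_apply_single (fderiv ℝ Q z),
      ← sum_coord_smul_apply_single (fderiv ℝ (energyDensity P Q U V) z)]
    simp only [spaceDiv, hFd, Finset.mul_sum, ← Finset.sum_sub_distrib, ← Finset.sum_add_distrib,
      PiLp.add_apply, PiLp.sub_apply, PiLp.smul_apply, smul_eq_mul]
    exact Finset.sum_congr rfl fun j _ => by ring
  have hsplit : ∀ {G : Type} [NormedAddCommGroup G] [NormedSpace ℝ G]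
      (L : ℝ × EuclideanSpace ℝ (Fin d) →L[ℝ] G), L (0, U z - V z) = L (0, U z) - L (0, V z) :=
    fun L => by rw [← map_sub]; simp
  have i1 := hPU.inner_eq (U z - V z)
  have i2 := hQV.inner_eq (U z - V z)
  rw [hdiv, hed, hed]
  simp only [inner_sub_right, hsplit] at i1 i2 ⊢
  linear_combination (P z - Q z) * (hPU.1 - hQV.1) + i1 - i2

theorem abs_mul_abs_le_energyDensity {d : ℕ} (P Q : ℝ × EuclideanSpace ℝ (Fin d) → ℝ)
    (U V : ℝ × EuclideanSpace ℝ (Fin d) → EuclideanSpace ℝ (Fin d))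
    (z : ℝ × EuclideanSpace ℝ (Fin d)) :
    |P z - Q z| * ‖U z - V z‖ ≤ energyDensity P Q U V z := by
  unfold energyDensity
  nlinarith [sq_nonneg (|P z - Q z| - ‖U z - V z‖), sq_abs (P z - Q z)]

theorem energyDensity_nonneg {d : ℕ} (P Q : ℝ × EuclideanSpace ℝ (Fin d) → ℝ)
    (U V : ℝ × EuclideanSpace ℝ (Fin d) → EuclideanSpace ℝ (Fin d))
    (z : ℝ × EuclideanSpace ℝ (Fin d)) : 0 ≤ energyDensity P Q U V z := by
  unfold energyDensity
  positivity

theorem energyDensity_eq_zero {d : ℕ} {P Q : ℝ × EuclideanSpace ℝ (Fin d) → ℝ}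
    {U V : ℝ × EuclideanSpace ℝ (Fin d) → EuclideanSpace ℝ (Fin d)}
    {z : ℝ × EuclideanSpace ℝ (Fin d)} :
    energyDensity P Q U V z = 0 ↔ P z = Q z ∧ U z = V z := by
  constructor
  · intro h
    unfold energyDensity at h
    have h1 : (P z - Q z) ^ 2 = 0 := by nlinarith [sq_nonneg (P z - Q z), sq_nonneg ‖U z - V z‖]
    have h2 : ‖U z - V z‖ ^ 2 = 0 := by nlinarith
    exact ⟨sub_eq_zero.1 (pow_eq_zero_iff two_ne_zero |>.1 h1),
      sub_eq_zero.1 (norm_eq_zero.1 (pow_eq_zero_iff two_ne_zero |>.1 h2))⟩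
  · rintro ⟨h1, h2⟩
    simp [energyDensity, h1, h2]

theorem norm_energyFlux_le {d : ℕ} (g : ℝ → ℝ) (P Q : ℝ × EuclideanSpace ℝ (Fin d) → ℝ)
    (U V : ℝ × EuclideanSpace ℝ (Fin d) → EuclideanSpace ℝ (Fin d))
    (z : ℝ × EuclideanSpace ℝ (Fin d)) :
    ‖energyFlux g P Q U V z‖ ≤ (|g (P z)| + ‖U z‖) * energyDensity P Q U V z := by
  have h1 := energyDensity_nonneg P Q U V z
  have h2 := mul_le_mul_of_nonneg_left (abs_mul_abs_le_energyDensity P Q U V z)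
    (abs_nonneg (g (P z)))
  refine (norm_add_le _ _).trans ?_
  rw [norm_smul, norm_smul, norm_mul, Real.norm_of_nonneg h1, Real.norm_eq_abs, Real.norm_eq_abs]
  linarith

theorem energy_balance_le {d : ℕ} {g : ℝ → ℝ} {g' B L : ℝ}
    {P Q : ℝ × EuclideanSpace ℝ (Fin d) → ℝ}
    {U V : ℝ × EuclideanSpace ℝ (Fin d) → EuclideanSpace ℝ (Fin d)}
    {z : ℝ × EuclideanSpace ℝ (Fin d)}
    (hP : DifferentiableAt ℝ P z) (hQ : DifferentiableAt ℝ Q z)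
    (hU : DifferentiableAt ℝ U z) (hV : DifferentiableAt ℝ V z) (hg : HasDerivAt g g' (P z))
    (hPU : SolvesAt g P U z) (hQV : SolvesAt g Q V z)
    (hPB : ‖fderiv ℝ P z‖ ≤ B) (hQB : ‖fderiv ℝ Q z‖ ≤ B)
    (hUB : ‖fderiv ℝ U z‖ ≤ B) (hVB : ‖fderiv ℝ V z‖ ≤ B)
    (hg' : |g'| ≤ L) (hgL : |g (P z) - g (Q z)| ≤ L * |P z - Q z|) :
    fderiv ℝ (energyDensity P Q U V) z (1, 0) + spaceDiv (energyFlux g P Q U V) z ≤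
      (d * B + 2 * (L * B + B + L * (d * B) + B + L * B)) * energyDensity P Q U V z := by
  rw [energy_balance hP hQ hU hV hg hPU hQV]
  set p := P z - Q z with hp
  set w := U z - V z with hw
  set e := energyDensity P Q U V z with he
  have hB : 0 ≤ B := (norm_nonneg _).trans hPB
  have hL : 0 ≤ L := (abs_nonneg _).trans hg'
  have he0 : 0 ≤ e := energyDensity_nonneg P Q U V z
  have hee : e = (p ^ 2 + ‖w‖ ^ 2) / 2 := rfl
  have hpw : |p| * ‖w‖ ≤ 2 * e := by
    linarith [abs_mul_abs_le_energyDensity P Q U V z]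
  have hpp : |p| * |p| ≤ 2 * e := by
    rw [abs_mul_abs_self]; nlinarith [sq_nonneg ‖w‖]
  have hww : ‖w‖ * ‖w‖ ≤ 2 * e := by nlinarith [sq_nonneg p]
  have hn : ‖((0 : ℝ), w)‖ = ‖w‖ := by simp [Prod.norm_mk]
  have hPw : |fderiv ℝ P z (0, w)| ≤ B * ‖w‖ := by
    simpa only [hn, Real.norm_eq_abs] using (fderiv ℝ P z).le_of_opNorm_le hPB (0, w)
  have hQw : |fderiv ℝ Q z (0, w)| ≤ B * ‖w‖ := by
    simpa only [hn, Real.norm_eq_abs] using (fderiv ℝ Q z).le_of_opNorm_le hQB (0, w)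
  have hVw : ‖fderiv ℝ V z (0, w)‖ ≤ B * ‖w‖ := by
    simpa only [hn] using (fderiv ℝ V z).le_of_opNorm_le hVB (0, w)
  have t1 : e * spaceDiv U z ≤ e * (d * B) :=
    mul_le_mul_of_nonneg_left ((le_abs_self _).trans (abs_spaceDiv_le hUB)) he0
  have t2 : |g' * p * fderiv ℝ P z (0, w)| ≤ L * B * (2 * e) := by
    rw [abs_mul, abs_mul]
    calc _ ≤ L * |p| * (B * ‖w‖) := by gcongr
      _ = L * B * (|p| * ‖w‖) := by ring
      _ ≤ _ := by gcongr
  have t3 : |p * fderiv ℝ Q z (0, w)| ≤ B * (2 * e) := by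
    rw [abs_mul]
    calc _ ≤ |p| * (B * ‖w‖) := by gcongr
      _ = B * (|p| * ‖w‖) := by ring
      _ ≤ _ := by gcongr
  have t4 : |p * (g (P z) - g (Q z)) * spaceDiv V z| ≤ L * (d * B) * (2 * e) := by
    rw [abs_mul, abs_mul]
    calc _ ≤ |p| * (L * |p|) * (d * B) := by
          gcongr
          exact abs_spaceDiv_le hVB
      _ = L * (d * B) * (|p| * |p|) := by ring
      _ ≤ _ := by gcongr
  have t5 : |inner ℝ w (fderiv ℝ V z (0, w))| ≤ B * (2 * e) := by
    calc _ ≤ ‖w‖ * ‖fderiv ℝ V z (0, w)‖ := abs_real_inner_le_norm _ _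
      _ ≤ ‖w‖ * (B * ‖w‖) := by gcongr
      _ = B * (‖w‖ * ‖w‖) := by ring
      _ ≤ _ := by gcongr
  have t6 : |(g (P z) - g (Q z)) * fderiv ℝ Q z (0, w)| ≤ L * B * (2 * e) := by
    rw [abs_mul]
    calc _ ≤ L * |p| * (B * ‖w‖) := by gcongr
      _ = L * B * (|p| * ‖w‖) := by ring
      _ ≤ _ := by gcongr
  have := (abs_le.1 t2).2
  have := (abs_le.1 t3).1
  have := (abs_le.1 t4).1
  have := (abs_le.1 t5).1
  have := (abs_le.1 t6).1
  linarith

/-- Finite propagation speed for the symmetric system with sound speed `g P`. -/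
theorem eq_on_cone_of_solvesAt {d : ℕ} {T R M : ℝ} (hT : 0 < T)
    (hM : 0 ≤ M) {g : ℝ → ℝ} (hg : ContDiff ℝ 1 g) {P Q : ℝ × EuclideanSpace ℝ (Fin d) → ℝ}
    {U V : ℝ × EuclideanSpace ℝ (Fin d) → EuclideanSpace ℝ (Fin d)}
    (hP : ContDiffOn ℝ 1 P (Set.Icc 0 T ×ˢ Set.univ))
    (hQ : ContDiffOn ℝ 1 Q (Set.Icc 0 T ×ˢ Set.univ))
    (hU : ContDiffOn ℝ 1 U (Set.Icc 0 T ×ˢ Set.univ))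
    (hV : ContDiffOn ℝ 1 V (Set.Icc 0 T ×ˢ Set.univ))
    (hPU : ∀ t ∈ Set.Ioo 0 T, ∀ x, SolvesAt g P U (t, x))
    (hQV : ∀ t ∈ Set.Ioo 0 T, ∀ x, SolvesAt g Q V (t, x))
    {x₀ : EuclideanSpace ℝ (Fin d)}
    (hspeed : ∀ t ∈ Set.Icc 0 T, ∀ x, ‖x - x₀‖ ≤ R → |g (P (t, x))| + ‖U (t, x)‖ ≤ M)
    (hinit : ∀ x, ‖x - x₀‖ ≤ R → P (0, x) = Q (0, x) ∧ U (0, x) = V (0, x)) :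
    ∀ t ∈ Set.Icc 0 T, ∀ x, ‖x - x₀‖ < R - M * t → P (t, x) = Q (t, x) ∧ U (t, x) = V (t, x) := by
  have hK := isCompact_closedBall x₀ R
  have hball : ∀ x, ‖x - x₀‖ ≤ R → x ∈ Metric.closedBall x₀ R := fun x hx => by
    rwa [Metric.mem_closedBall, dist_eq_norm]
  have hsub : Set.Icc 0 T ×ˢ Metric.closedBall x₀ R ⊆ Set.Icc 0 T ×ˢ Set.univ :=
    Set.prod_mono le_rfl (Set.subset_univ _)
  have hIoo : Set.Ioo 0 T ×ˢ (Set.univ : Set (EuclideanSpace ℝ (Fin d))) ⊆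
      Set.Icc 0 T ×ˢ Set.univ := Set.prod_mono Set.Ioo_subset_Icc_self le_rfl
  obtain ⟨BP, hBP⟩ := exists_bound_fderiv hT hK hP
  obtain ⟨BQ, hBQ⟩ := exists_bound_fderiv hT hK hQ
  obtain ⟨BU, hBU⟩ := exists_bound_fderiv hT hK hU
  obtain ⟨BV, hBV⟩ := exists_bound_fderiv hT hK hV
  obtain ⟨NP, hNP⟩ := (isCompact_Icc.prod hK).exists_bound_of_continuousOn
    (hP.continuousOn.mono hsub)
  obtain ⟨NQ, hNQ⟩ := (isCompact_Icc.prod hK).exists_bound_of_continuousOn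
    (hQ.continuousOn.mono hsub)
  set N := max NP NQ
  obtain ⟨L, hL⟩ := (isCompact_Icc (a := -N) (b := N)).exists_bound_of_continuousOn
    (hg.continuous_deriv le_rfl).continuousOn
  set B := max (max BP BQ) (max BU BV) with hB
  have hgd : ∀ s, HasDerivAt g (deriv g s) s := fun s =>
    ((hg.differentiable one_ne_zero) s).hasDerivAt
  have hPQ : ContDiffOn ℝ 1 (energyDensity P Q U V) (Set.Icc 0 T ×ˢ Set.univ) :=
    (((hP.sub hQ).pow 2).add ((hU.sub hV).norm_sq ℝ)).div_const 2
  have hflux : ContDiffOn ℝ 1 (energyFlux g P Q U V) (Set.Icc 0 T ×ˢ Set.univ) :=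
    (hPQ.smul hU).add (((hg.comp_contDiffOn hP).mul (hP.sub hQ)).smul (hU.sub hV))
  intro t ht x hx
  refine energyDensity_eq_zero.1 (eq_zero_on_cone hM hPQ.continuousOn (hPQ.mono hIoo)
    (hflux.mono hIoo) (fun _ _ _ => energyDensity_nonneg _ _ _ _ _)
    (fun x hx => energyDensity_eq_zero.2 (hinit x hx))
    (fun t ht x hx => (norm_energyFlux_le g P Q U V (t, x)).trans
      (mul_le_mul_of_nonneg_right (hspeed t (Set.Ioo_subset_Icc_self ht) x hx)
        (energyDensity_nonneg P Q U V (t, x))))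
    (C := d * B + 2 * (L * B + B + L * (d * B) + B + L * B)) ?_ t ht x hx)
  intro t ht x hx
  have hn : Set.Icc 0 T ×ˢ (Set.univ : Set (EuclideanSpace ℝ (Fin d))) ∈ nhds (t, x) :=
    prod_mem_nhds (Icc_mem_nhds ht.1 ht.2) Filter.univ_mem
  have hmem : (t, x) ∈ Set.Icc 0 T ×ˢ Metric.closedBall x₀ R :=
    ⟨Set.Ioo_subset_Icc_self ht, hball x hx⟩
  have hPN : P (t, x) ∈ Set.Icc (-N) N := abs_le.1 ((hNP _ hmem).trans (le_max_left _ _))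
  have hQN : Q (t, x) ∈ Set.Icc (-N) N := abs_le.1 ((hNQ _ hmem).trans (le_max_right _ _))
  exact energy_balance_le ((hP.contDiffAt hn).differentiableAt one_ne_zero)
    ((hQ.contDiffAt hn).differentiableAt one_ne_zero)
    ((hU.contDiffAt hn).differentiableAt one_ne_zero)
    ((hV.contDiffAt hn).differentiableAt one_ne_zero) (hgd _) (hPU t ht x) (hQV t ht x)
    ((hBP t ht x (hball x hx)).trans (by simp [hB]))
    ((hBQ t ht x (hball x hx)).trans (by simp [hB]))
    ((hBU t ht x (hball x hx)).trans (by simp [hB]))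
    ((hBV t ht x (hball x hx)).trans (by simp [hB]))
    (hL _ hPN)
    ((convex_Icc (-N) N).norm_image_sub_le_of_norm_hasDerivWithin_le
      (fun s _ => (hgd s).hasDerivWithinAt) hL hQN hPN)

theorem solvesAt_uncurry {d : ℕ} {T a b ν : ℝ} (hν : ν ≠ 0)
    {π : ℝ → EuclideanSpace ℝ (Fin d) → ℝ}
    {u : ℝ → EuclideanSpace ℝ (Fin d) → EuclideanSpace ℝ (Fin d)}
    (hπ : ContDiffOn ℝ 1 (Function.uncurry π) (Set.Icc 0 T ×ˢ Set.univ))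
    (hu : ContDiffOn ℝ 1 (Function.uncurry u) (Set.Icc 0 T ×ˢ Set.univ))
    {t : ℝ} (ht : t ∈ Set.Ioo 0 T) {x : EuclideanSpace ℝ (Fin d)} (hpos : 0 ≤ π t x)
    (heqπ : deriv (fun t' => π t' x) t +
        (∑ j, u t x j * fderiv ℝ (π t) x (EuclideanSpace.single j 1)) +
        a * (1 + b * π t x ^ (ν - 1)) * π t x *
          (∑ j, fderiv ℝ (fun y => u t y j) x (EuclideanSpace.single j 1)) = 0)
    (hequ : ∀ i, deriv (fun t' => u t' x i) t +
        (∑ j, u t x j * fderiv ℝ (fun y => u t y i) x (EuclideanSpace.single j 1)) +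
        a * (1 + b * π t x ^ (ν - 1)) * π t x *
          fderiv ℝ (π t) x (EuclideanSpace.single i 1) = 0) :
    SolvesAt (fun s => a * (s + b * s ^ ν)) (Function.uncurry π) (Function.uncurry u) (t, x) := by
  have hn : Set.Icc 0 T ×ˢ (Set.univ : Set (EuclideanSpace ℝ (Fin d))) ∈ nhds (t, x) :=
    prod_mem_nhds (Icc_mem_nhds ht.1 ht.2) Filter.univ_mem
  have hπd := (hπ.contDiffAt hn).differentiableAt one_ne_zero
  have hud := (hu.contDiffAt hn).differentiableAt one_ne_zero
  have e1 : deriv (fun t' => π t' x) t = fderiv ℝ (Function.uncurry π) (t, x) (1, 0) :=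
    (hasDerivAt_slice hπd).deriv
  have e2 : ∀ v, fderiv ℝ (π t) x v = fderiv ℝ (Function.uncurry π) (t, x) (0, v) := fun v => by
    have h : fderiv ℝ (π t) x = _ := (hasFDerivAt_slice hπd).fderiv
    rw [h]
    simp
  have e3 : ∀ i, deriv (fun t' => u t' x i) t =
      fderiv ℝ (Function.uncurry u) (t, x) (1, 0) i := fun i =>
    ((EuclideanSpace.proj (𝕜 := ℝ) i).hasFDerivAt.comp_hasDerivAt t (hasDerivAt_slice hud)).deriv
  have e4 : ∀ i v, fderiv ℝ (fun y => u t y i) x v =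
      fderiv ℝ (Function.uncurry u) (t, x) (0, v) i := fun i v => by
    have h : fderiv ℝ (fun y => u t y i) x = _ :=
      ((EuclideanSpace.proj (𝕜 := ℝ) i).hasFDerivAt.comp x
      (hasFDerivAt_slice hud)).fderiv
    rw [h]
    simp
  have e5 : a * (1 + b * π t x ^ (ν - 1)) * π t x = a * (π t x + b * π t x ^ ν) := by
    have h := Real.rpow_add_one' (y := ν - 1) hpos (by simpa using hν)
    rw [sub_add_cancel] at h
    rw [h]
    ring
  simp only [e1, e2, e3, e4, e5] at heqπ hequ
  refine ⟨?_, fun i => ?_⟩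
  · rw [← sum_coord_smul_apply_single]
    exact heqπ
  · rw [← sum_coord_smul_apply_single (fderiv ℝ (Function.uncurry u) (t, x))]
    simpa using hequ i


/-- Finite-speed-of-propagation local uniqueness for the isentropic symmetrized
Van der Waals–Euler system: two `C¹` solutions with the same initial data on the
ball `B̄(x0,R)` coincide on the cone `{(t,x) : 0 ≤ t ≤ T1, |x-x0| ≤ R - Mt}`,
where `M` is the maximal propagation speed and `T1 = min(T0, R/M)`. -/
theorem stmt11 (d : ℕ) (hd : 1 ≤ d) (γ0 btilde : ℝ) (hγ0 : 1 < γ0)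
    (hbt : 0 ≤ btilde) (ν : ℝ) (hν : ν = (γ0 + 1) / (γ0 - 1))
    (T0 : ℝ) (hT0 : 0 < T0)
    (π πt : ℝ → EuclideanSpace ℝ (Fin d) → ℝ)
    (u ut : ℝ → EuclideanSpace ℝ (Fin d) → EuclideanSpace ℝ (Fin d))
    (hreg : ContDiffOn ℝ 1 (Function.uncurry fun t x => (π t x, u t x))
      (Set.Icc (0 : ℝ) T0 ×ˢ (Set.univ : Set (EuclideanSpace ℝ (Fin d)))))
    (hregt : ContDiffOn ℝ 1 (Function.uncurry fun t x => (πt t x, ut t x))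
      (Set.Icc (0 : ℝ) T0 ×ˢ (Set.univ : Set (EuclideanSpace ℝ (Fin d)))))
    (hπpos : ∀ t ∈ Set.Icc (0 : ℝ) T0, ∀ x, 0 ≤ π t x)
    (hπtpos : ∀ t ∈ Set.Icc (0 : ℝ) T0, ∀ x, 0 ≤ πt t x)
    (hgradt : ∃ Cb : ℝ, ∀ t ∈ Set.Icc (0 : ℝ) T0, ∀ x,
      ‖fderiv ℝ (fun y => ((πt t y : ℝ), ut t y)) x‖ ≤ Cb)
    (heqπ : ∀ t ∈ Set.Icc (0 : ℝ) T0, ∀ x,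
      deriv (fun t' => π t' x) t +
        (∑ j, u t x j * fderiv ℝ (π t) x (EuclideanSpace.single j 1)) +
        ((γ0 - 1) / 2) * (1 + btilde * π t x ^ (ν - 1)) * π t x *
          (∑ j, fderiv ℝ (fun y => u t y j) x (EuclideanSpace.single j 1)) = 0)
    (hequ : ∀ t ∈ Set.Icc (0 : ℝ) T0, ∀ x, ∀ i,
      deriv (fun t' => u t' x i) t +
        (∑ j, u t x j * fderiv ℝ (fun y => u t y i) x (EuclideanSpace.single j 1)) +
        ((γ0 - 1) / 2) * (1 + btilde * π t x ^ (ν - 1)) * π t x *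
          fderiv ℝ (π t) x (EuclideanSpace.single i 1) = 0)
    (heqπt : ∀ t ∈ Set.Icc (0 : ℝ) T0, ∀ x,
      deriv (fun t' => πt t' x) t +
        (∑ j, ut t x j * fderiv ℝ (πt t) x (EuclideanSpace.single j 1)) +
        ((γ0 - 1) / 2) * (1 + btilde * πt t x ^ (ν - 1)) * πt t x *
          (∑ j, fderiv ℝ (fun y => ut t y j) x (EuclideanSpace.single j 1)) = 0)
    (hequt : ∀ t ∈ Set.Icc (0 : ℝ) T0, ∀ x, ∀ i,
      deriv (fun t' => ut t' x i) t +
        (∑ j, ut t x j * fderiv ℝ (fun y => ut t y i) x (EuclideanSpace.single j 1)) +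
        ((γ0 - 1) / 2) * (1 + btilde * πt t x ^ (ν - 1)) * πt t x *
          fderiv ℝ (πt t) x (EuclideanSpace.single i 1) = 0)
    (x0 : EuclideanSpace ℝ (Fin d)) (R : ℝ) (hR : 0 < R)
    (M : ℝ)
    (hM : M = sSup {y : ℝ | ∃ t x, 0 ≤ t ∧ t ≤ T0 ∧ dist x x0 ≤ R ∧
      y = ((γ0 - 1) / 2) * |π t x| * (1 + btilde * π t x ^ (ν - 1)) + ‖u t x‖})
    (hinit : ∀ x, dist x x0 ≤ R → π 0 x = πt 0 x ∧ u 0 x = ut 0 x) :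
    ∀ t x, 0 ≤ t → t ≤ min T0 (R / M) → dist x x0 ≤ R - M * t →
      π t x = πt t x ∧ u t x = ut t x := by
  have hγ : 0 < γ0 - 1 := sub_pos.2 hγ0
  have hν1 : 1 < ν := by
    rw [hν, one_lt_div hγ]
    linarith
  set g : ℝ → ℝ := fun s => (γ0 - 1) / 2 * (s + btilde * s ^ ν) with hg
  have hgC : ContDiff ℝ 1 g :=
    contDiff_const.mul (contDiff_id.add (contDiff_const.mul
      (Real.contDiff_rpow_const_of_le (n := 1) (by simpa using hν1.le))))
  have hπC : ContDiffOn ℝ 1 (Function.uncurry π) (Set.Icc 0 T0 ×ˢ Set.univ) := hreg.fst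
  have huC : ContDiffOn ℝ 1 (Function.uncurry u) (Set.Icc 0 T0 ×ˢ Set.univ) := hreg.snd
  have hπtC : ContDiffOn ℝ 1 (Function.uncurry πt) (Set.Icc 0 T0 ×ˢ Set.univ) := hregt.fst
  have hutC : ContDiffOn ℝ 1 (Function.uncurry ut) (Set.Icc 0 T0 ×ˢ Set.univ) := hregt.snd
  have hspeed_eq : ∀ t ∈ Set.Icc 0 T0, ∀ x, |g (π t x)| + ‖u t x‖ =
      ((γ0 - 1) / 2) * |π t x| * (1 + btilde * π t x ^ (ν - 1)) + ‖u t x‖ := fun t ht x => by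
    have h0 := hπpos t ht x
    have h := Real.rpow_add_one' (y := ν - 1) h0 (by simpa using (by linarith : ν ≠ 0))
    rw [sub_add_cancel] at h
    have hr := Real.rpow_nonneg h0 ν
    rw [abs_of_nonneg (a := g (π t x)) (by positivity), abs_of_nonneg h0, hg]
    dsimp only
    rw [h]
    ring
  have hspeed : ∀ t ∈ Set.Icc 0 T0, ∀ x, ‖x - x0‖ ≤ R → |g (π t x)| + ‖u t x‖ ≤ M := by
    obtain ⟨B, hB⟩ := (isCompact_Icc.prod (isCompact_closedBall x0 R)).exists_bound_of_continuousOn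
      (f := fun z : ℝ × EuclideanSpace ℝ (Fin d) =>
        |g (Function.uncurry π z)| + ‖Function.uncurry u z‖)
      (((hgC.continuous.comp_continuousOn hπC.continuousOn).abs.add huC.continuousOn.norm).mono
        (Set.prod_mono (le_refl (Set.Icc 0 T0)) (Set.subset_univ _)))
    intro t ht x hx
    rw [hM, hspeed_eq t ht x]
    refine le_csSup ⟨B, ?_⟩ ⟨t, x, ht.1, ht.2, by rwa [dist_eq_norm], rfl⟩
    rintro y ⟨s, z, hs0, hsT, hz, rfl⟩
    rw [← hspeed_eq s ⟨hs0, hsT⟩ z]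
    exact (le_abs_self _).trans (hB (s, z) ⟨⟨hs0, hsT⟩, hz⟩)
  have hM0 : 0 ≤ M := by
    have := hspeed 0 ⟨le_rfl, hT0.le⟩ x0 (by simpa using hR.le)
    exact le_trans (by positivity) this
  have hcone := eq_on_cone_of_solvesAt hT0 hM0 hgC hπC hπtC huC hutC
    (fun t ht x => solvesAt_uncurry (by linarith) hπC huC ht
      (hπpos t (Set.Ioo_subset_Icc_self ht) x) (heqπ t (Set.Ioo_subset_Icc_self ht) x)
      (hequ t (Set.Ioo_subset_Icc_self ht) x))
    (fun t ht x => solvesAt_uncurry (by linarith) hπtC hutC ht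
      (hπtpos t (Set.Ioo_subset_Icc_self ht) x) (heqπt t (Set.Ioo_subset_Icc_self ht) x)
      (hequt t (Set.Ioo_subset_Icc_self ht) x))
    hspeed (fun x hx => hinit x (by rwa [dist_eq_norm]))
  intro t x ht0 htT hx
  have htT0 : t ≤ T0 := htT.trans (min_le_left _ _)
  rw [dist_eq_norm] at hx
  let path : ℝ → ℝ × EuclideanSpace ℝ (Fin d) := fun s => (s * t, x0 + s • (x - x0))
  have hpath : Continuous path := by fun_prop
  have hpath1 : path 1 = (t, x) := by simp [path]
  have hmaps : Set.MapsTo path (Set.Icc 0 1) (Set.Icc 0 T0 ×ˢ Set.univ) := fun s hs =>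
    ⟨⟨mul_nonneg hs.1 ht0, (mul_le_of_le_one_left ht0 hs.2).trans htT0⟩, trivial⟩
  have heq : Set.EqOn
      (fun s => (Function.uncurry π (path s), Function.uncurry u (path s)))
      (fun s => (Function.uncurry πt (path s), Function.uncurry ut (path s)))
      (Set.Ico 0 1) := fun s hs => by
    have h1 := hcone (s * t) (hmaps ⟨hs.1, hs.2.le⟩).1 (x0 + s • (x - x0)) (by
      rw [add_sub_cancel_left, norm_smul, Real.norm_of_nonneg hs.1]
      nlinarith [hs.1, hs.2])
    exact Prod.ext h1.1 h1.2
  have hcl := heq.of_subset_closure (t := Set.Icc 0 1)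
    ((hπC.continuousOn.comp hpath.continuousOn hmaps).prodMk
      (huC.continuousOn.comp hpath.continuousOn hmaps))
    ((hπtC.continuousOn.comp hpath.continuousOn hmaps).prodMk
      (hutC.continuousOn.comp hpath.continuousOn hmaps))
    Set.Ico_subset_Icc_self (by rw [closure_Ico zero_ne_one])
  have h1 := hcl (Set.right_mem_Icc.2 zero_le_one)
  simp only [hpath1] at h1
  exact Prod.mk.inj h1
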